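/- Let u_1, u_2 ∈ M_d be hermitian. The expected value map 𝔼|_{𝓜_d} : 𝓜_d → W(u_1,u_2) is open at every state ρ ∈ 𝓜_d such that 𝔼(ρ) is not a multiply generated round boundary point of W(u_1,u_2). -/

import Mathlib

open Set Filter Topology Matrix
open scoped ComplexOrder

/-- The joint numerical range `W(u₁,u₂) ⊆ ℝ²` of two (hermitian) matrices. -/
def jointNR {d : ℕ} (u₁ u₂ : Matrix (Fin d) (Fin d) ℂ) : Set (ℝ × ℝ) :=
  {p | ∃ x : Fin d → ℂ, star x ⬝ᵥ x = 1 ∧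
    p = ((star x ⬝ᵥ u₁.mulVec x).re, (star x ⬝ᵥ u₂.mulVec x).re)}

/-- The state space `𝓜_d`: positive semidefinite matrices of trace one. -/
def stateSpace (d : ℕ) : Set (Matrix (Fin d) (Fin d) ℂ) :=
  {ρ | ρ.PosSemidef ∧ ρ.trace = 1}

/-- The expected value map `ρ ↦ (tr(u₁ρ), tr(u₂ρ))` (real for hermitian arguments). -/
noncomputable def expVal2 {d : ℕ} (u₁ u₂ : Matrix (Fin d) (Fin d) ℂ)
    (ρ : Matrix (Fin d) (Fin d) ℂ) : ℝ × ℝ :=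
  ((u₁ * ρ).trace.re, (u₂ * ρ).trace.re)

/-- `f` restricted to `K` (viewed as a map onto `L`, both with subspace topologies) is open at
`v ∈ K` if the image of every neighborhood of `v` in `K` is a neighborhood of `f v` in `L`. -/
def MapsOpenAt {X Y : Type*} [TopologicalSpace X] [TopologicalSpace Y]
    (f : X → Y) (K : Set X) (L : Set Y) (v : X) : Prop :=
  ∀ N : Set X, N ⊆ K → N ∈ nhdsWithin v K → f '' N ∈ nhdsWithin (f v) L

/-- A supporting line of `C` at `p`: the level set of a nonzero linear functional attaining
its maximum over `C` at `p`. -/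
def IsSupportingLineAt (C : Set (ℝ × ℝ)) (p : ℝ × ℝ) (l : Set (ℝ × ℝ)) : Prop :=
  ∃ (φ : (ℝ × ℝ) →ₗ[ℝ] ℝ) (c : ℝ), φ ≠ 0 ∧ l = {q | φ q = c} ∧ φ p = c ∧ ∀ q ∈ C, φ q ≤ c

/-- A corner point of `C`: a point of `C` lying on more than one supporting line. -/
def IsCornerPoint (C : Set (ℝ × ℝ)) (p : ℝ × ℝ) : Prop :=
  p ∈ C ∧ ∃ l₁ l₂ : Set (ℝ × ℝ), l₁ ≠ l₂ ∧ IsSupportingLineAt C p l₁ ∧ IsSupportingLineAt C p l₂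

/-- A round boundary point of `C`: a boundary point which is neither a corner point nor lies
in the relative interior of a flat boundary portion (a nondegenerate segment in the boundary). -/
def IsRoundBoundaryPoint (C : Set (ℝ × ℝ)) (p : ℝ × ℝ) : Prop :=
  p ∈ frontier C ∧ ¬ IsCornerPoint C p ∧
    ¬ ∃ a b : ℝ × ℝ, a ≠ b ∧ segment ℝ a b ⊆ frontier C ∧ p ∈ openSegment ℝ a b

/-- `z` is singularly generated if all unit vectors generating it are proportional. -/
def SinglyGenerated {d : ℕ} (u₁ u₂ : Matrix (Fin d) (Fin d) ℂ) (z : ℝ × ℝ) : Prop :=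
  ∀ x y : Fin d → ℂ, star x ⬝ᵥ x = 1 → star y ⬝ᵥ y = 1 →
    ((star x ⬝ᵥ u₁.mulVec x).re, (star x ⬝ᵥ u₂.mulVec x).re) = z →
    ((star y ⬝ᵥ u₁.mulVec y).re, (star y ⬝ᵥ u₂.mulVec y).re) = z →
    ∃ c : ℂ, y = c • x

/-- `z` is multiply generated if it lies in the joint numerical range but is not
singularly generated. -/
def MultiplyGenerated {d : ℕ} (u₁ u₂ : Matrix (Fin d) (Fin d) ℂ) (z : ℝ × ℝ) : Prop :=
  z ∈ jointNR u₁ u₂ ∧ ¬ SinglyGenerated u₁ u₂ z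

/-- A matrix is unitarily reducible if it is unitarily equivalent to a block diagonal matrix
with (at least) two proper diagonal blocks. -/
def UnitarilyReducible {d : ℕ} (A : Matrix (Fin d) (Fin d) ℂ) : Prop :=
  ∃ (a b : ℕ) (hab : a + b = d), 0 < a ∧ 0 < b ∧
    ∃ U ∈ Matrix.unitaryGroup (Fin d) ℂ,
      ∃ (B : Matrix (Fin a) (Fin a) ℂ) (C : Matrix (Fin b) (Fin b) ℂ),
        star U * A * U =
          Matrix.reindex (finSumFinEquiv.trans (finCongr hab))
            (finSumFinEquiv.trans (finCongr hab)) (Matrix.fromBlocks B 0 0 C)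

/-- A simplex is the convex hull of finitely many affinely independent points. -/
def IsSimplex {Y : Type*} [AddCommGroup Y] [Module ℝ Y] (S : Set Y) : Prop :=
  ∃ s : Finset Y, AffineIndependent ℝ (fun p : (s : Set Y) => (p : Y)) ∧
    S = convexHull ℝ (s : Set Y)

/-- `w` is a simplicial point of `C` if finitely many simplices contained in `C`
cover a neighborhood of `w` in `C`. -/
def IsSimplicialPoint {Y : Type*} [AddCommGroup Y] [Module ℝ Y] [TopologicalSpace Y]
    (C : Set Y) (w : Y) : Prop :=
  ∃ (m : ℕ) (S : Fin m → Set Y),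
    (∀ i, IsSimplex (S i) ∧ S i ⊆ C) ∧ (⋃ i, S i) ∈ nhdsWithin w C

/-- A face of a convex set `C`: a convex subset `F ⊆ C` such that any segment of `C` whose
relative interior meets `F` lies in `F` (i.e. `F` is convex and extreme in `C`). -/
def IsFaceOf {Y : Type*} [AddCommGroup Y] [Module ℝ Y] (C F : Set Y) : Prop :=
  Convex ℝ F ∧ IsExtreme ℝ C F

/-- The dimension of a convex set: the dimension of its affine hull. -/
noncomputable def convDim {Y : Type*} [NormedAddCommGroup Y] [NormedSpace ℝ Y]
    (C : Set Y) : ℕ :=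
  Module.finrank ℝ (affineSpan ℝ C).direction

section StateSpace

variable {d : ℕ}

lemma expVal2_add (u₁ u₂ ρ σ : Matrix (Fin d) (Fin d) ℂ) :
    expVal2 u₁ u₂ (ρ + σ) = expVal2 u₁ u₂ ρ + expVal2 u₁ u₂ σ := by
  simp [expVal2, mul_add]

lemma expVal2_smul (u₁ u₂ : Matrix (Fin d) (Fin d) ℂ) (r : ℝ) (ρ : Matrix (Fin d) (Fin d) ℂ) :
    expVal2 u₁ u₂ (r • ρ) = r • expVal2 u₁ u₂ ρ := by
  simp [expVal2]

lemma trace_mul_vecMulVec_star (A : Matrix (Fin d) (Fin d) ℂ) (x : Fin d → ℂ) :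
    (A * vecMulVec x (star x)).trace = star x ⬝ᵥ A *ᵥ x := by
  rw [mul_vecMulVec, trace_vecMulVec, dotProduct_comm]

lemma expVal2_vecMulVec (u₁ u₂ : Matrix (Fin d) (Fin d) ℂ) (x : Fin d → ℂ) :
    expVal2 u₁ u₂ (vecMulVec x (star x)) =
      ((star x ⬝ᵥ u₁ *ᵥ x).re, (star x ⬝ᵥ u₂ *ᵥ x).re) := by
  simp [expVal2, trace_mul_vecMulVec_star]

lemma continuous_expVal2 (u₁ u₂ : Matrix (Fin d) (Fin d) ℂ) :
    Continuous (expVal2 u₁ u₂) := by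
  unfold expVal2
  fun_prop

lemma vecMulVec_mem_stateSpace {x : Fin d → ℂ} (hx : star x ⬝ᵥ x = 1) :
    vecMulVec x (star x) ∈ stateSpace d :=
  ⟨posSemidef_vecMulVec_self_star x, by rw [trace_vecMulVec, dotProduct_comm, hx]⟩

lemma jointNR_subset_image (u₁ u₂ : Matrix (Fin d) (Fin d) ℂ) :
    jointNR u₁ u₂ ⊆ expVal2 u₁ u₂ '' stateSpace d := by
  rintro p ⟨x, hx, rfl⟩
  exact ⟨_, vecMulVec_mem_stateSpace hx, expVal2_vecMulVec u₁ u₂ x⟩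

lemma convex_stateSpace : Convex ℝ (stateSpace d) := by
  rintro ρ ⟨hρ, tρ⟩ σ ⟨hσ, tσ⟩ a b ha hb hab
  refine ⟨(hρ.smul ha).add (hσ.smul hb), ?_⟩
  simp only [trace_add, trace_smul, tρ, tσ]
  rw [← add_smul, hab, one_smul]

lemma convex_image_expVal2 (u₁ u₂ : Matrix (Fin d) (Fin d) ℂ) :
    Convex ℝ (expVal2 u₁ u₂ '' stateSpace d) := by
  rintro _ ⟨ρ, hρ, rfl⟩ _ ⟨σ, hσ, rfl⟩ a b ha hb hab
  exact ⟨a • ρ + b • σ, convex_stateSpace hρ hσ ha hb hab, by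
    simp [expVal2_add, expVal2_smul]⟩

lemma norm_apply_le_trace {ρ : Matrix (Fin d) (Fin d) ℂ} (hρ : ρ.PosSemidef) (i j : Fin d) :
    ‖ρ i j‖ ≤ ρ.trace.re := by
  obtain ⟨m, v, rfl⟩ := posSemidef_iff_eq_sum_vecMulVec.1 hρ
  simp only [Matrix.sum_apply, vecMulVec_apply, trace_sum, trace_vecMulVec, Complex.re_sum]
  refine (norm_sum_le _ _).trans (Finset.sum_le_sum fun k _ => ?_)
  have key : ∀ l, ‖v k l‖ ^ 2 ≤ (v k ⬝ᵥ star (v k)).re := by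
    intro l
    have h : (v k ⬝ᵥ star (v k)).re = ∑ l, ‖v k l‖ ^ 2 := by
      simp only [dotProduct, Pi.star_apply, RCLike.star_def, Complex.mul_conj, Complex.re_sum,
        Complex.ofReal_re, Complex.normSq_eq_norm_sq]
    rw [h]
    exact Finset.single_le_sum (f := fun l => ‖v k l‖ ^ 2) (fun _ _ => by positivity)
      (Finset.mem_univ l)
  have h1 := key i
  have h2 := key j
  rw [norm_mul, Pi.star_apply, norm_star]
  nlinarith [sq_nonneg (‖v k i‖ - ‖v k j‖)]

lemma norm_apply_le_one {ρ : Matrix (Fin d) (Fin d) ℂ} (hρ : ρ ∈ stateSpace d) (i j : Fin d) :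
    ‖ρ i j‖ ≤ 1 := by
  simpa [hρ.2] using norm_apply_le_trace hρ.1 i j

lemma isCompact_stateSpace : IsCompact (stateSpace d) := by
  have hK : IsCompact (Set.pi univ fun _ : Fin d => Set.pi univ fun _ : Fin d =>
      Metric.closedBall (0 : ℂ) 1) :=
    isCompact_univ_pi fun _ => isCompact_univ_pi fun _ => isCompact_closedBall _ _
  have hc : IsClosed (stateSpace d) := by
    have : stateSpace d = {ρ | ρᴴ = ρ} ∩
        (⋂ x : Fin d → ℂ, {ρ | 0 ≤ star x ⬝ᵥ (ρ *ᵥ x)}) ∩ {ρ | ρ.trace = 1} := by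
      ext ρ
      simp [stateSpace, posSemidef_iff_dotProduct_mulVec, IsHermitian]
    rw [this]
    refine ((isClosed_eq (by fun_prop) (by fun_prop)).inter
      (isClosed_iInter fun x => ?_)).inter (isClosed_eq (by fun_prop) (by fun_prop))
    exact isClosed_le continuous_const (by fun_prop)
  refine hK.of_isClosed_subset hc fun ρ hρ i _ j _ => ?_
  simpa using norm_apply_le_one hρ i j

lemma trace_mul_nonneg {H σ : Matrix (Fin d) (Fin d) ℂ} (hH : H.PosSemidef)
    (hσ : σ.PosSemidef) : 0 ≤ (H * σ).trace.re := by
  obtain ⟨m, v, rfl⟩ := posSemidef_iff_eq_sum_vecMulVec.1 hσ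
  simp only [Finset.mul_sum, trace_sum, Complex.re_sum, trace_mul_vecMulVec_star]
  exact Finset.sum_nonneg fun i _ => hH.re_dotProduct_nonneg (v i)

lemma mapsOpenAt_of_eventually_lift {u₁ u₂ ρ : Matrix (Fin d) (Fin d) ℂ}
    (h : ∀ ε > 0, ∀ᶠ q in 𝓝 (expVal2 u₁ u₂ ρ), ∀ σ ∈ stateSpace d, expVal2 u₁ u₂ σ = q →
      ∃ ρ' ∈ stateSpace d, (∀ i j, ‖ρ' i j - ρ i j‖ < ε) ∧ expVal2 u₁ u₂ ρ' = q) :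
    MapsOpenAt (expVal2 u₁ u₂) (stateSpace d) (jointNR u₁ u₂) ρ := by
  intro N _ hN
  obtain ⟨ε, hε, hball⟩ : ∃ ε > 0, ∀ ρ' ∈ stateSpace d,
      (∀ i j, ‖ρ' i j - ρ i j‖ < ε) → ρ' ∈ N := by
    obtain ⟨ε, hε, hb⟩ := (Metric.mem_nhdsWithin_iff (α := Fin d → Fin d → ℂ)).1 hN
    refine ⟨ε, hε, fun ρ' hρ' hd => hb ⟨?_, hρ'⟩⟩
    refine (dist_pi_lt_iff hε).2 fun i => (dist_pi_lt_iff hε).2 fun j => ?_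
    rw [dist_eq_norm]
    exact hd i j
  filter_upwards [nhdsWithin_le_nhds (h ε hε), self_mem_nhdsWithin] with q hq hqW
  obtain ⟨σ, hσ, rfl⟩ := jointNR_subset_image u₁ u₂ hqW
  obtain ⟨ρ', hρ', hd, he⟩ := hq σ hσ rfl
  exact ⟨ρ', hball ρ' hρ' hd, he⟩

end StateSpace

lemma exists_forall_add_smul_mem {K : Set (ℝ × ℝ)} (hK : Convex ℝ K) {a b z : ℝ × ℝ}
    (ha : a ∈ K) (hb : b ∈ K) (hz : z ∈ openSegment ℝ a b) :
    ∃ δ > 0, ∀ p ∈ K, ∀ r m : ℝ, 0 ≤ r → r < δ → |m| < δ →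
      z + r • (p - z) + m • (b - a) ∈ K := by
  obtain ⟨α, β, hα, hβ, hαβ, rfl⟩ := hz
  refine ⟨min (1 / 2) (min (α / 2) (β / 2)), by positivity, fun p hp r m hr hrδ hm => ?_⟩
  simp only [lt_min_iff, abs_lt] at hrδ hm
  have hr1 : 0 < 1 - r := by linarith
  set m' := m / (1 - r) with hm'
  have hmm : m = m' * (1 - r) := by rw [hm']; field_simp
  have h1 : -α ≤ m' := by
    rw [hm', le_div_iff₀ hr1]; nlinarith [hm.2.1.1]
  have h1' : m' ≤ α := by
    rw [hm', div_le_iff₀ hr1]; nlinarith [hm.2.1.2]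
  have h2 : -β ≤ m' := by
    rw [hm', le_div_iff₀ hr1]; nlinarith [hm.2.2.1]
  have hmem : (α - m') • a + (β + m') • b ∈ K :=
    hK ha hb (by linarith) (by linarith) (by linarith)
  convert hK hmem hp hr1.le hr (by ring) using 1
  rw [hmm]
  module

lemma eventually_homothety_mem {K : Set (ℝ × ℝ)} (hK : Convex ℝ K) {a b z : ℝ × ℝ}
    (ha : a ∈ K) (hb : b ∈ K) (hab : a ≠ b) (hz : z ∈ openSegment ℝ a b) {t : ℝ} (ht : 0 < t) :
    ∀ᶠ q in 𝓝 z, q ∈ K → z + t⁻¹ • (q - z) ∈ K := by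
  obtain ⟨δ, hδ, hmem⟩ := exists_forall_add_smul_mem hK ha hb hz
  set D := b - a with hD
  have hn : 0 < D.1 ^ 2 + D.2 ^ 2 := by
    have : D ≠ 0 := sub_ne_zero.2 hab.symm
    rcases eq_or_ne D.1 0 with h | h
    · have : D.2 ≠ 0 := fun h' => this (Prod.ext h h')
      positivity
    · positivity
  let ψ : ℝ × ℝ → ℝ := fun q => D.1 * (q.2 - z.2) - D.2 * (q.1 - z.1)
  have hψ : Continuous ψ := by fun_prop
  have hψz : ψ z = 0 := by simp [ψ]
  have aux : ∀ p ∈ K, ∀ᶠ q in 𝓝 z, 0 ≤ ψ q / ψ p → ψ q = ψ q / ψ p * ψ p →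
      z + t⁻¹ • (q - z) ∈ K := by
    intro p hp
    let r : ℝ × ℝ → ℝ := fun q => ψ q / ψ p / t
    let m : ℝ × ℝ → ℝ := fun q => (D.1 * (q.1 - z.1) + D.2 * (q.2 - z.2) -
      ψ q / ψ p * (D.1 * (p.1 - z.1) + D.2 * (p.2 - z.2))) / (D.1 ^ 2 + D.2 ^ 2) / t
    have hr : Tendsto r (𝓝 z) (𝓝 0) := by
      have : Continuous r := by fun_prop
      simpa [r, hψz] using this.tendsto z
    have hm : Tendsto (fun q => |m q|) (𝓝 z) (𝓝 0) := by
      have : Continuous fun q => |m q| := by fun_prop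
      simpa [m, hψz] using this.tendsto z
    filter_upwards [hr.eventually_lt_const hδ, hm.eventually_lt_const hδ] with q hrq hmq h0 hq
    convert hmem p hp (r q) (m q) (by positivity) hrq hmq using 1
    rw [add_assoc]
    congr 1
    generalize hs : ψ q / ψ p = s at *
    simp only [r, m, hs]
    simp only [ψ] at hq
    ext
    · simp
      field_simp
      linear_combination (-D.2) * hq
    · simp
      field_simp
      linear_combination (D.1) * hq
  have hzK : z ∈ K := hK.openSegment_subset ha hb hz
  have hpos : ∀ᶠ q in 𝓝 z, q ∈ K → 0 < ψ q → z + t⁻¹ • (q - z) ∈ K := by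
    by_cases h : ∃ p ∈ K, 0 < ψ p
    · obtain ⟨p, hp, hpp⟩ := h
      filter_upwards [aux p hp] with q hq _ h0
      exact hq (by positivity) (by field_simp)
    · push Not at h
      exact Eventually.of_forall fun q hq h0 => absurd (h q hq) (not_le.2 h0)
  have hneg : ∀ᶠ q in 𝓝 z, q ∈ K → ψ q < 0 → z + t⁻¹ • (q - z) ∈ K := by
    by_cases h : ∃ p ∈ K, ψ p < 0
    · obtain ⟨p, hp, hpp⟩ := h
      filter_upwards [aux p hp] with q hq _ h0
      exact hq (div_nonneg_of_nonpos h0.le hpp.le) (by rw [div_mul_cancel₀ _ hpp.ne])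
    · push Not at h
      exact Eventually.of_forall fun q hq h0 => absurd (h q hq) (not_le.2 h0)
  filter_upwards [hpos, hneg, aux z hzK] with q h1 h2 h3 hq
  rcases lt_trichotomy (ψ q) 0 with h | h | h
  · exact h2 hq h
  · exact h3 (by simp [h]) (by simp [h])
  · exact h1 hq h

lemma mapsOpenAt_of_mem_openSegment {d : ℕ} {u₁ u₂ ρ : Matrix (Fin d) (Fin d) ℂ}
    (hρ : ρ ∈ stateSpace d) {a b : ℝ × ℝ} (ha : a ∈ expVal2 u₁ u₂ '' stateSpace d)
    (hb : b ∈ expVal2 u₁ u₂ '' stateSpace d) (hab : a ≠ b)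
    (hz : expVal2 u₁ u₂ ρ ∈ openSegment ℝ a b) :
    MapsOpenAt (expVal2 u₁ u₂) (stateSpace d) (jointNR u₁ u₂) ρ := by
  refine mapsOpenAt_of_eventually_lift fun ε hε => ?_
  obtain ⟨t, ht0, ht⟩ := exists_between (lt_min one_pos (half_pos hε))
  obtain ⟨ht1, htε⟩ := lt_min_iff.1 ht
  filter_upwards [eventually_homothety_mem (convex_image_expVal2 u₁ u₂) ha hb hab hz ht0]
    with q hq σ hσ hσq
  obtain ⟨τ, hτ, hτq⟩ := hq ⟨σ, hσ, hσq⟩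
  refine ⟨(1 - t) • ρ + t • τ, convex_stateSpace hρ hτ (by linarith) ht0.le (by ring),
    fun i j => ?_, ?_⟩
  · have : ((1 - t) • ρ + t • τ) i j - ρ i j = t • (τ i j - ρ i j) := by
      simp only [Matrix.add_apply, Matrix.smul_apply]
      module
    rw [this, norm_smul, Real.norm_of_nonneg ht0.le]
    nlinarith [norm_sub_le (τ i j) (ρ i j), norm_apply_le_one hρ i j, norm_apply_le_one hτ i j]
  · rw [expVal2_add, expVal2_smul, expVal2_smul, hτq, smul_add, smul_smul,
      mul_inv_cancel₀ ht0.ne']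
    module

lemma exists_unit_smul_eq {d : ℕ} {v : Fin d → ℂ} (hv : v ≠ 0) :
    ∃ r : ℝ, 0 < r ∧ ∃ y : Fin d → ℂ, star y ⬝ᵥ y = 1 ∧ v = (r : ℂ) • y := by
  obtain ⟨l, hl, hvl⟩ : ∃ l : ℝ, 0 < l ∧ star v ⬝ᵥ v = (l : ℂ) := by
    have := dotProduct_star_self_pos_iff.2 hv
    rw [Complex.pos_iff] at this
    exact ⟨_, this.1, Complex.ext rfl (by simpa using this.2.symm)⟩
  have hsq : ((√l : ℝ) : ℂ) * ((√l : ℝ) : ℂ) = (l : ℂ) := by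
    rw [← Complex.ofReal_mul, Real.mul_self_sqrt hl.le]
  have hs0 : ((√l : ℝ) : ℂ) ≠ 0 := by
    simpa using (Real.sqrt_pos.2 hl).ne'
  refine ⟨√l, Real.sqrt_pos.2 hl, ((√l : ℝ) : ℂ)⁻¹ • v, ?_, ?_⟩
  · rw [star_smul, smul_dotProduct, dotProduct_smul, hvl, ← hsq]
    simp only [star_inv₀, RCLike.star_def, Complex.conj_ofReal, smul_eq_mul]
    field_simp
  · rw [smul_smul, mul_inv_cancel₀ hs0, one_smul]

lemma eq_vecMulVec_of_singlyGenerated {d : ℕ} {u₁ u₂ : Matrix (Fin d) (Fin d) ℂ} {z : ℝ × ℝ}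
    (hext : ∀ a ∈ expVal2 u₁ u₂ '' stateSpace d, ∀ b ∈ expVal2 u₁ u₂ '' stateSpace d,
      z ∈ openSegment ℝ a b → a = b)
    (hs : SinglyGenerated u₁ u₂ z) {x : Fin d → ℂ} (hx : star x ⬝ᵥ x = 1)
    (hxz : expVal2 u₁ u₂ (vecMulVec x (star x)) = z) {σ : Matrix (Fin d) (Fin d) ℂ}
    (hσ : σ ∈ stateSpace d) (hσz : expVal2 u₁ u₂ σ = z) :
    σ = vecMulVec x (star x) := by
  obtain ⟨m, v, hv⟩ := posSemidef_iff_eq_sum_vecMulVec.1 hσ.1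
  have key : ∀ i, ∃ c : ℂ, v i = c • x := by
    intro i
    rcases eq_or_ne (v i) 0 with h0 | h0
    · exact ⟨0, by simp [h0]⟩
    obtain ⟨r, hr, y, hy1, hvy⟩ := exists_unit_smul_eq h0
    obtain ⟨l, hl, hvv⟩ : ∃ l : ℝ, 0 < l ∧
        vecMulVec (v i) (star (v i)) = l • vecMulVec y (star y) := by
      refine ⟨r * r, by positivity, ?_⟩
      rw [hvy, star_smul, vecMulVec_smul, smul_vecMulVec, smul_smul, RCLike.star_def,
        Complex.conj_ofReal, ← Complex.ofReal_mul]
      rfl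
    set τ := ∑ j ∈ Finset.univ.erase i, vecMulVec (v j) (star (v j)) with hτ
    have hτp : τ.PosSemidef := posSemidef_sum _ fun j _ => posSemidef_vecMulVec_self_star _
    have hστ : σ = l • vecMulVec y (star y) + τ := by
      rw [hv, ← hvv, hτ, Finset.add_sum_erase _ (fun j => vecMulVec (v j) (star (v j)))
        (Finset.mem_univ i)]
    have htr : τ.trace = ((1 - l : ℝ) : ℂ) := by
      have h := hσ.2
      rw [hστ, trace_add, trace_smul, (vecMulVec_mem_stateSpace hy1).2] at h
      rw [← sub_eq_iff_eq_add'.2 h.symm]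
      simp
    have hyz : expVal2 u₁ u₂ (vecMulVec y (star y)) = z := by
      have hl1 : 0 ≤ 1 - l := by
        have := hτp.trace_nonneg
        rw [htr] at this
        exact_mod_cast this
      rcases hl1.eq_or_lt with h1 | h1
      · have : τ = 0 := hτp.trace_eq_zero_iff.1 (by rw [htr, ← h1]; simp)
        rw [← hσz, hστ, this, show l = 1 by linarith]
        simp
      · have hβ : (1 - l)⁻¹ • τ ∈ stateSpace d := by
          refine ⟨hτp.smul (inv_nonneg.2 hl1), ?_⟩
          rw [trace_smul, htr, Complex.real_smul, ← Complex.ofReal_mul,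
            inv_mul_cancel₀ h1.ne', Complex.ofReal_one]
        have hz : z = l • expVal2 u₁ u₂ (vecMulVec y (star y)) +
            (1 - l) • expVal2 u₁ u₂ ((1 - l)⁻¹ • τ) := by
          rw [← hσz, hστ, expVal2_add, expVal2_smul, expVal2_smul, smul_smul,
            mul_inv_cancel₀ h1.ne', one_smul]
        have := hext _ ⟨_, vecMulVec_mem_stateSpace hy1, rfl⟩ _ ⟨_, hβ, rfl⟩
          ⟨l, 1 - l, hl, h1, by ring, hz.symm⟩
        rw [hz, ← this, ← add_smul]
        simp
    rw [expVal2_vecMulVec] at hyz hxz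
    obtain ⟨c, hc⟩ := hs x y hx hy1 hxz hyz
    exact ⟨(r : ℂ) * c, by rw [hvy, hc, smul_smul]⟩
  choose c hc using key
  have hσs : σ = (∑ i, c i * star (c i)) • vecMulVec x (star x) := by
    rw [hv, Finset.sum_smul]
    refine Finset.sum_congr rfl fun i _ => ?_
    rw [hc i, star_smul, vecMulVec_smul, smul_vecMulVec, smul_smul, mul_comm]
  have h := hσ.2
  rw [hσs, trace_smul, (vecMulVec_mem_stateSpace hx).2, smul_eq_mul, mul_one] at h
  rw [hσs, h, one_smul]

lemma mapsOpenAt_of_unique_preimage {d : ℕ} {u₁ u₂ ρ : Matrix (Fin d) (Fin d) ℂ}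
    (huniq : ∀ σ ∈ stateSpace d, expVal2 u₁ u₂ σ = expVal2 u₁ u₂ ρ → σ = ρ) :
    MapsOpenAt (expVal2 u₁ u₂) (stateSpace d) (jointNR u₁ u₂) ρ := by
  refine mapsOpenAt_of_eventually_lift fun ε hε => ?_
  let C : Set (Matrix (Fin d) (Fin d) ℂ) := stateSpace d ∩ {σ | ∃ i j, ε ≤ ‖σ i j - ρ i j‖}
  have hC : IsCompact C := by
    refine isCompact_stateSpace.inter_right ?_
    simp only [ofPred_exists]
    exact isClosed_iUnion_of_finite fun i => isClosed_iUnion_of_finite fun j =>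
      isClosed_le continuous_const (by fun_prop)
  have hz : expVal2 u₁ u₂ ρ ∉ expVal2 u₁ u₂ '' C := by
    rintro ⟨σ, ⟨hσ, i, j, hij⟩, hσz⟩
    rw [huniq σ hσ hσz] at hij
    simp at hij
    linarith
  filter_upwards [(hC.image (continuous_expVal2 u₁ u₂)).isClosed.isOpen_compl.mem_nhds hz]
    with q hq σ hσ hσq
  refine ⟨σ, hσ, fun i j => ?_, hσq⟩
  by_contra hij
  exact hq ⟨σ, ⟨hσ, i, j, not_lt.1 hij⟩, hσq⟩

lemma exists_range_projection {d : ℕ} {H : Matrix (Fin d) (Fin d) ℂ} (hH : H.PosSemidef) :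
    ∃ (P : Matrix (Fin d) (Fin d) ℂ) (c : ℝ), P.IsHermitian ∧ P * P = P ∧ H * (1 - P) = 0 ∧
      (c • H - P).PosSemidef := by
  set U : Matrix (Fin d) (Fin d) ℂ := ↑hH.1.eigenvectorUnitary
  have hUU : star U * U = 1 := Unitary.coe_star_mul_self _
  set h := hH.1.eigenvalues
  have hspec : H = U * diagonal (fun i => (h i : ℂ)) * star U := by
    conv_lhs => rw [hH.1.spectral_theorem, Unitary.conjStarAlgAut_apply]
    rfl
  let p : Fin d → ℂ := fun i => if h i = 0 then 0 else 1
  refine ⟨U * diagonal p * star U, ∑ i, (h i)⁻¹, ?_, ?_, ?_, ?_⟩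
  · rw [IsHermitian, star_eq_conjTranspose, conjTranspose_mul, conjTranspose_mul,
      conjTranspose_conjTranspose, diagonal_conjTranspose, mul_assoc]
    congr 3
    ext i
    simp only [p, Pi.star_apply]
    split_ifs <;> simp
  · calc _ = U * diagonal p * (star U * U) * diagonal p * star U := by simp only [mul_assoc]
      _ = _ := by
        rw [hUU, mul_one, mul_assoc U, diagonal_mul_diagonal]
        congr 3
        ext i
        simp only [p]
        split_ifs <;> simp
  · have : U * diagonal (fun i => (h i : ℂ)) * star U * (U * diagonal p * star U) = H := by
      calc _ = U * diagonal (fun i => (h i : ℂ)) * (star U * U) * diagonal p * star U := by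
            simp only [mul_assoc]
        _ = _ := by
          rw [hUU, mul_one, mul_assoc U, diagonal_mul_diagonal]
          conv_rhs => rw [hspec]
          congr 3
          ext i
          simp only [p]
          split_ifs with h0 <;> simp [h0]
    rw [mul_sub, mul_one]
    nth_rw 2 [hspec]
    rw [this, sub_self]
  · have hd : (∑ i, (h i)⁻¹) • H - U * diagonal p * star U =
        U * diagonal (fun i => ((∑ j, (h j)⁻¹ : ℝ) : ℂ) * h i - p i) * star U := by
      have hdiag : diagonal (fun i => ((∑ j, (h j)⁻¹ : ℝ) : ℂ) * h i - p i) =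
          (∑ j, (h j)⁻¹) • diagonal (fun i => (h i : ℂ)) - diagonal p := by
        ext i j
        rcases eq_or_ne i j with rfl | hij
        · simp
        · simp [hij]
      rw [hdiag, mul_sub, sub_mul, Matrix.mul_smul, Matrix.smul_mul, ← hspec]
    rw [hd]
    refine PosSemidef.mul_mul_conjTranspose_same (posSemidef_diagonal_iff.2 fun i => ?_) U
    have hnn : ∀ j, 0 ≤ h j := hH.eigenvalues_nonneg
    simp only [p]
    split_ifs with h0
    · simp [h0]
    · have h1 : (h i)⁻¹ ≤ ∑ j, (h j)⁻¹ :=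
        Finset.single_le_sum (f := fun j => (h j)⁻¹) (fun j _ => inv_nonneg.2 (hnn j))
          (Finset.mem_univ i)
      have h2 : 0 ≤ (∑ j, (h j)⁻¹) * h i - 1 := by
        have := mul_le_mul_of_nonneg_right h1 (hnn i)
        rw [inv_mul_cancel₀ h0] at this
        linarith
      exact_mod_cast h2

lemma Matrix.PosSemidef.mul_eq_zero_of_add_mul_eq_zero {d : ℕ} {A B Q : Matrix (Fin d) (Fin d) ℂ}
    (hA : A.PosSemidef) (hB : B.PosSemidef) (hQ : (A + B) * Q = 0) : A * Q = 0 := by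
  refine ext_of_mulVec_single fun j => ?_
  rw [zero_mulVec, ← mulVec_mulVec]
  set w := Q *ᵥ Pi.single j 1
  have hw : star w ⬝ᵥ A *ᵥ w + star w ⬝ᵥ B *ᵥ w = 0 := by
    rw [← dotProduct_add, ← add_mulVec, mulVec_mulVec, hQ, zero_mulVec, dotProduct_zero]
  refine (hA.dotProduct_mulVec_zero_iff w).1 ?_
  exact ((add_eq_zero_iff_of_nonneg (hA.dotProduct_mulVec_nonneg w)
    (hB.dotProduct_mulVec_nonneg w)).1 hw).1

/-- The hermitian matrix whose expected value in a state `σ` is `c - φ (expVal2 u₁ u₂ σ)`. -/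
noncomputable def gapMatrix {d : ℕ} (u₁ u₂ : Matrix (Fin d) (Fin d) ℂ)
    (φ : (ℝ × ℝ) →ₗ[ℝ] ℝ) (c : ℝ) : Matrix (Fin d) (Fin d) ℂ :=
  c • 1 - (φ (1, 0) • u₁ + φ (0, 1) • u₂)

lemma apply_eq_fst_mul_add_snd_mul (φ : (ℝ × ℝ) →ₗ[ℝ] ℝ) (q : ℝ × ℝ) :
    φ q = q.1 * φ (1, 0) + q.2 * φ (0, 1) := by
  have h : q = q.1 • (1, 0) + q.2 • (0, 1) := by ext <;> simp
  conv_lhs => rw [h, map_add, map_smul, map_smul, smul_eq_mul, smul_eq_mul]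

lemma trace_gapMatrix_mul {d : ℕ} (u₁ u₂ : Matrix (Fin d) (Fin d) ℂ) (φ : (ℝ × ℝ) →ₗ[ℝ] ℝ)
    (c : ℝ) (σ : Matrix (Fin d) (Fin d) ℂ) :
    (gapMatrix u₁ u₂ φ c * σ).trace.re = c * σ.trace.re - φ (expVal2 u₁ u₂ σ) := by
  rw [apply_eq_fst_mul_add_snd_mul]
  simp [gapMatrix, expVal2, sub_mul, add_mul]
  ring

lemma posSemidef_gapMatrix {d : ℕ} {u₁ u₂ : Matrix (Fin d) (Fin d) ℂ}
    (h₁ : u₁.IsHermitian) (h₂ : u₂.IsHermitian) {φ : (ℝ × ℝ) →ₗ[ℝ] ℝ} {c : ℝ}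
    (hφ : ∀ q ∈ jointNR u₁ u₂, φ q ≤ c) : (gapMatrix u₁ u₂ φ c).PosSemidef := by
  have hH : (gapMatrix u₁ u₂ φ c).IsHermitian := by
    simp [gapMatrix, IsHermitian, conjTranspose_sub, conjTranspose_add, conjTranspose_smul,
      h₁.eq, h₂.eq]
  refine .of_dotProduct_mulVec_nonneg hH fun x => ?_
  refine Complex.nonneg_iff.2 ⟨?_, (hH.im_star_dotProduct_mulVec_self x).symm⟩
  rcases eq_or_ne x 0 with rfl | hx
  · simp
  obtain ⟨r, hr, y, hy, rfl⟩ := exists_unit_smul_eq hx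
  have h := trace_gapMatrix_mul u₁ u₂ φ c (vecMulVec y (star y))
  rw [trace_mul_vecMulVec_star, (vecMulVec_mem_stateSpace hy).2, expVal2_vecMulVec] at h
  have hle := hφ _ ⟨y, hy, rfl⟩
  rw [star_smul, smul_dotProduct, mulVec_smul, dotProduct_smul, smul_smul, RCLike.star_def,
    Complex.conj_ofReal, ← Complex.ofReal_mul, smul_eq_mul, Complex.re_ofReal_mul, h]
  refine mul_nonneg (by positivity) ?_
  simpa using hle

lemma apply_eq_zero_iff_of_apply_eq_zero {φ : (ℝ × ℝ) →ₗ[ℝ] ℝ} (hφ : φ ≠ 0) {w : ℝ × ℝ}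
    (hw : w ≠ 0) (hφw : φ w = 0) (v : ℝ × ℝ) : φ v = 0 ↔ w.1 * v.2 - w.2 * v.1 = 0 := by
  have hv := apply_eq_fst_mul_add_snd_mul φ v
  rw [apply_eq_fst_mul_add_snd_mul] at hφw
  constructor
  · intro h
    rw [hv] at h
    by_contra hne
    have h1 : φ (1, 0) = 0 :=
      (mul_eq_zero_iff_right hne).1 (by linear_combination v.2 * hφw - w.2 * h)
    have h2 : φ (0, 1) = 0 :=
      (mul_eq_zero_iff_right hne).1 (by linear_combination w.1 * h - v.1 * hφw)
    exact hφ (LinearMap.ext fun q => by rw [apply_eq_fst_mul_add_snd_mul, h1, h2]; simp)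
  · intro h
    by_contra hne
    have h1 : w.1 = 0 :=
      (mul_eq_zero_iff_right hne).1 (by
        rw [hv]; linear_combination v.1 * hφw + φ (0, 1) * h)
    have h2 : w.2 = 0 :=
      (mul_eq_zero_iff_right hne).1 (by
        rw [hv]; linear_combination v.2 * hφw - φ (1, 0) * h)
    exact hw (Prod.ext h1 h2)

lemma mapsOpenAt_of_isCornerPoint {d : ℕ} {u₁ u₂ ρ : Matrix (Fin d) (Fin d) ℂ}
    (h₁ : u₁.IsHermitian) (h₂ : u₂.IsHermitian) (hρ : ρ ∈ stateSpace d)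
    (hc : IsCornerPoint (jointNR u₁ u₂) (expVal2 u₁ u₂ ρ)) :
    MapsOpenAt (expVal2 u₁ u₂) (stateSpace d) (jointNR u₁ u₂) ρ := by
  obtain ⟨-, _, _, hne, ⟨φ, a, hφ, rfl, hφz, hφle⟩, ⟨ψ, b, hψ, rfl, hψz, hψle⟩⟩ := hc
  have hinj : ∀ p q : ℝ × ℝ, φ p = φ q → ψ p = ψ q → p = q := by
    intro p q hp hq
    by_contra hpq
    have hw : p - q ≠ 0 := sub_ne_zero.2 hpq
    refine hne (Set.ext fun v => ?_)
    have e1 := apply_eq_zero_iff_of_apply_eq_zero hφ hw (by simp [hp]) (v - expVal2 u₁ u₂ ρ)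
    have e2 := apply_eq_zero_iff_of_apply_eq_zero hψ hw (by simp [hq]) (v - expVal2 u₁ u₂ ρ)
    have e := e1.trans e2.symm
    rwa [map_sub, map_sub, hφz, hψz, sub_eq_zero, sub_eq_zero] at e
  set A := gapMatrix u₁ u₂ φ a
  set B := gapMatrix u₁ u₂ ψ b
  have hAp : A.PosSemidef := posSemidef_gapMatrix h₁ h₂ hφle
  have hBp : B.PosSemidef := posSemidef_gapMatrix h₁ h₂ hψle
  obtain ⟨P, c, hPh, hPP, hPH, hPc⟩ := exists_range_projection (hAp.add hBp)
  have compress : ∀ X : Matrix (Fin d) (Fin d) ℂ, X.IsHermitian → X * (1 - P) = 0 →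
      ∀ σ, (X * (P * σ * P)).trace = (X * σ).trace := by
    intro X hX hXP σ
    have h1 : X * P = X := by
      rw [mul_sub, mul_one, sub_eq_zero] at hXP
      exact hXP.symm
    have h2 : P * X = X := by
      have := congrArg conjTranspose h1
      rwa [conjTranspose_mul, hX.eq, hPh.eq] at this
    rw [mul_assoc P, ← mul_assoc X, h1, ← mul_assoc, trace_mul_comm, ← mul_assoc, h2]
  have hAP := compress A hAp.1 (hAp.mul_eq_zero_of_add_mul_eq_zero hBp hPH)
  have hBP := compress B hBp.1
    (hBp.mul_eq_zero_of_add_mul_eq_zero hAp (by rwa [add_comm B A]))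
  refine mapsOpenAt_of_eventually_lift fun ε hε => ?_
  have hlim : Tendsto (fun q => c * ((a - φ q) + (b - ψ q))) (𝓝 (expVal2 u₁ u₂ ρ)) (𝓝 0) := by
    have h1 : Continuous φ := φ.continuous_of_finiteDimensional
    have h2 : Continuous ψ := ψ.continuous_of_finiteDimensional
    have : Continuous fun q => c * ((a - φ q) + (b - ψ q)) := by fun_prop
    simpa [hφz, hψz] using this.tendsto (expVal2 u₁ u₂ ρ)
  filter_upwards [hlim.eventually_lt_const (lt_min one_pos (half_pos hε))] with q hq σ hσ hσq
  have hτ : (P * σ * P).PosSemidef := by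
    simpa [hPh.eq] using hσ.1.mul_mul_conjTranspose_same P
  set τ := P * σ * P with hτdef
  obtain ⟨s, hs⟩ : ∃ s : ℝ, τ.trace = (s : ℂ) :=
    ⟨τ.trace.re, Complex.ext rfl (by simpa using (Complex.nonneg_iff.1 hτ.trace_nonneg).2.symm)⟩
  have hs0 : 0 ≤ s := by
    have := hτ.trace_nonneg
    rw [hs] at this
    exact_mod_cast this
  have hsle : s ≤ c * ((a - φ q) + (b - ψ q)) := by
    have h := trace_mul_nonneg hPc hσ.1
    have hPσ : (P * σ).trace = (s : ℂ) := by
      rw [← hs, hτdef, trace_mul_comm (P * σ) P, ← mul_assoc, hPP]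
    rw [sub_mul, smul_mul, add_mul, trace_sub, trace_smul, trace_add, hPσ, Complex.sub_re,
      Complex.smul_re, Complex.add_re, trace_gapMatrix_mul, trace_gapMatrix_mul, hσ.2, hσq,
      Complex.ofReal_re, Complex.one_re, mul_one, mul_one, smul_eq_mul] at h
    linarith
  obtain ⟨hs1, hsε⟩ := lt_min_iff.1 (hsle.trans_lt hq)
  have htr : ((1 - s) • ρ + τ).trace = 1 := by
    rw [trace_add, trace_smul, hρ.2, hs]
    simp
  refine ⟨(1 - s) • ρ + τ, ⟨(hρ.1.smul (by linarith)).add hτ, htr⟩, fun i j => ?_, ?_⟩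
  · have : ((1 - s) • ρ + τ) i j - ρ i j = τ i j - s • ρ i j := by
      simp only [Matrix.add_apply, Matrix.smul_apply]
      module
    rw [this]
    have e1 := norm_sub_le (τ i j) (s • ρ i j)
    rw [norm_smul, Real.norm_of_nonneg hs0] at e1
    have e2 := norm_apply_le_trace hτ i j
    rw [hs, Complex.ofReal_re] at e2
    nlinarith [norm_apply_le_one hρ i j]
  · have value : ∀ (χ : (ℝ × ℝ) →ₗ[ℝ] ℝ) (e : ℝ), χ (expVal2 u₁ u₂ ρ) = e →
        (gapMatrix u₁ u₂ χ e * τ).trace = (gapMatrix u₁ u₂ χ e * σ).trace →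
        χ (expVal2 u₁ u₂ ((1 - s) • ρ + τ)) = χ q := by
      intro χ e hz heq
      have hσχ := trace_gapMatrix_mul u₁ u₂ χ e σ
      have hτχ := trace_gapMatrix_mul u₁ u₂ χ e τ
      rw [heq, hσχ, hσ.2, hs, hσq, Complex.one_re, Complex.ofReal_re] at hτχ
      rw [expVal2_add, expVal2_smul, map_add, map_smul, hz, smul_eq_mul]
      linarith
    exact hinj _ _ (value φ a hφz (hAP σ)) (value ψ b hψz (hBP σ))

lemma isClosed_jointNR {d : ℕ} (u₁ u₂ : Matrix (Fin d) (Fin d) ℂ) :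
    IsClosed (jointNR u₁ u₂) := by
  have hK : IsCompact {x : Fin d → ℂ | star x ⬝ᵥ x = 1} := by
    refine (isCompact_univ_pi fun _ : Fin d =>
      isCompact_closedBall (0 : ℂ) 1).of_isClosed_subset
      (isClosed_eq (by fun_prop) (by fun_prop)) fun x hx i _ => ?_
    have h := norm_apply_le_one (vecMulVec_mem_stateSpace hx) i i
    rw [vecMulVec_apply, norm_mul, Pi.star_apply, norm_star] at h
    rw [mem_closedBall_zero_iff]
    nlinarith [norm_nonneg (x i)]
  have : jointNR u₁ u₂ = (fun x : Fin d → ℂ =>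
      ((star x ⬝ᵥ u₁.mulVec x).re, (star x ⬝ᵥ u₂.mulVec x).re)) ''
      {x : Fin d → ℂ | star x ⬝ᵥ x = 1} := by
    ext p
    simp only [jointNR, mem_ofPred_eq, mem_image, eq_comm]
  rw [this]
  exact (hK.image (by fun_prop)).isClosed

theorem open_except_at_multiply_generated_round_points {d : ℕ}
    (u₁ u₂ : Matrix (Fin d) (Fin d) ℂ)
    (h₁ : u₁.IsHermitian) (h₂ : u₂.IsHermitian) :
    ∀ ρ ∈ stateSpace d,
      ¬ (MultiplyGenerated u₁ u₂ (expVal2 u₁ u₂ ρ) ∧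
          IsRoundBoundaryPoint (jointNR u₁ u₂) (expVal2 u₁ u₂ ρ)) →
      MapsOpenAt (expVal2 u₁ u₂) (stateSpace d) (jointNR u₁ u₂) ρ := by

  intro ρ hρ hgen
  set z := expVal2 u₁ u₂ ρ
  by_cases hext : ∀ a ∈ expVal2 u₁ u₂ '' stateSpace d, ∀ b ∈ expVal2 u₁ u₂ '' stateSpace d,
      z ∈ openSegment ℝ a b → a = b
  swap
  · push Not at hext
    obtain ⟨a, ha, b, hb, hzab, hab⟩ := hext
    exact mapsOpenAt_of_mem_openSegment hρ ha hb hab hzab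
  by_cases hzW : z ∈ jointNR u₁ u₂
  swap
  · intro N _ _
    rw [← (isClosed_jointNR u₁ u₂).closure_eq, mem_closure_iff_nhdsWithin_neBot,
      not_neBot] at hzW
    rw [hzW]
    exact mem_bot
  by_cases hs : SinglyGenerated u₁ u₂ z
  · obtain ⟨x, hx, hxz⟩ := hzW
    have hxz' : expVal2 u₁ u₂ (vecMulVec x (star x)) = z := by rw [hxz, expVal2_vecMulVec]
    refine mapsOpenAt_of_unique_preimage fun σ hσ hσz => ?_
    rw [eq_vecMulVec_of_singlyGenerated hext hs hx hxz' hσ hσz,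
      ← eq_vecMulVec_of_singlyGenerated hext hs hx hxz' hρ rfl]
  by_cases hc : IsCornerPoint (jointNR u₁ u₂) z
  · exact mapsOpenAt_of_isCornerPoint h₁ h₂ hρ hc
  refine absurd ⟨⟨hzW, hs⟩, ?_, hc, ?_⟩ hgen
  · refine ⟨subset_closure hzW, fun hint => ?_⟩
    obtain ⟨ε, hε, hb⟩ := Metric.mem_nhds_iff.1 (mem_interior_iff_mem_nhds.1 hint)
    have hmem : ∀ r : ℝ, |r| < ε → (z.1 + r, z.2) ∈ expVal2 u₁ u₂ '' stateSpace d := by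
      intro r hr
      refine jointNR_subset_image u₁ u₂ (hb ?_)
      simp [Prod.dist_eq, hr]
    have habs : |ε / 2| < ε := by rw [abs_of_pos (half_pos hε)]; linarith
    have h := hext _ (hmem (ε / 2) habs) _ (hmem (-(ε / 2)) (by rwa [abs_neg]))
      ⟨1 / 2, 1 / 2, by norm_num, by norm_num, by norm_num, by
        ext
        · simp; ring
        · simp; ring⟩
    have := congrArg Prod.fst h
    simp only at this
    linarith
  · rintro ⟨a, b, hab, hseg, hzab⟩
    have hsub : frontier (jointNR u₁ u₂) ⊆ expVal2 u₁ u₂ '' stateSpace d :=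
      (isClosed_jointNR u₁ u₂).frontier_subset.trans (jointNR_subset_image u₁ u₂)
    exact hab (hext a (hsub (hseg (left_mem_segment ℝ a b))) b
      (hsub (hseg (right_mem_segment ℝ a b))) hzab)
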